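/- Let G be a finite group, (A,α) an algebra with G-action, (E, S, Θ_A(E)) a G-equivariant right functional (A,α)-module, F a right functional A-module (with no G-action assumed), and (Γ, Γ^*) : E → F a functional extension of the underlying (non-equivariant) functional A-modules. Equip ⊕_{g∈G} E and ⊕_{g∈G} F with the twisted right A-actions (⊕_g ξ_g)·a := ⊕_g ξ_g·α_{g⁻¹}(a), the shift G-actions U_h(⊕_g ξ_g) := ⊕_g ξ_{h⁻¹g} and V_h(⊕_g η_g) := ⊕_g η_{h⁻¹g}, and the functional spaces {⊕_g α_g ∘ χ_g : χ_g ∈ Θ_A(E)} and {⊕_g α_g ∘ χ_g : χ_g ∈ Θ_A(F)}, where (⊕_g ψ_g)(⊕_g ξ_g) := Σ_g ψ_g(ξ_g). Then σ(⊕_g ξ_g) := ⊕_g Γ(ξ_g) together with σ^*(⊕_g α_g ∘ χ_g) := ⊕_g α_g ∘ Γ^*(χ_g) is a G-equivariant functional extension σ : (⊕_{g∈G} E, U) → (⊕_{g∈G} F, V); consequently, composing with the regular embedding π(ξ) := ⊕_{g∈G} S_{g⁻¹}(ξ), π^*(φ) := (1/|G|)⊕_{g∈G} φ ∘ S_g,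 the composition σ ∘ π is a G-equivariant functional extension of (E,S) into (⊕_{g∈G} F, V). -/

import Mathlib

open scoped BigOperators TensorProduct

noncomputable section

/-- A right module structure for a (not necessarily unital) ℂ-algebra `A`
on a ℂ-vector space `E`. -/
structure RightMod (A : Type*) [NonUnitalRing A] [Module ℂ A]
    (E : Type*) [AddCommGroup E] [Module ℂ E] where
  sm : E → A → E
  add_sm : ∀ (x y : E) (a : A), sm (x + y) a = sm x a + sm y a
  sm_add : ∀ (x : E) (a b : A), sm x (a + b) = sm x a + sm x b
  sm_mul : ∀ (x : E) (a b : A), sm (sm x a) b = sm x (a * b)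
  csm_left : ∀ (c : ℂ) (x : E) (a : A), sm (c • x) a = c • sm x a
  csm_right : ∀ (c : ℂ) (x : E) (a : A), sm x (c • a) = c • sm x a

variable {A : Type*} [NonUnitalRing A] [Module ℂ A]

/-- `f : E → A` is a right `A`-module homomorphism into the standard module `A`. -/
def IsFunctional {E : Type*} [AddCommGroup E] [Module ℂ E]
    (r : RightMod A E) (f : E → A) : Prop :=
  (∀ x y : E, f (x + y) = f x + f y) ∧ (∀ (c : ℂ) (x : E), f (c • x) = c • f x) ∧
    ∀ (x : E) (a : A), f (r.sm x a) = f x * a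

/-- `Θ` is a functional space for the right `A`-module `(E, r)`:
a `G`-invariant left `A`-submodule of `Hom_A(E,A)`. -/
structure IsFunctionalSpace {E : Type*} [AddCommGroup E] [Module ℂ E]
    (r : RightMod A E) (Θ : Set (E → A)) : Prop where
  functional : ∀ φ ∈ Θ, IsFunctional r φ
  zero_mem : (0 : E → A) ∈ Θ
  add_mem : ∀ {φ ψ : E → A}, φ ∈ Θ → ψ ∈ Θ → φ + ψ ∈ Θ
  neg_mem : ∀ {φ : E → A}, φ ∈ Θ → -φ ∈ Θ
  csmul_mem : ∀ (c : ℂ) {φ : E → A}, φ ∈ Θ → c • φ ∈ Θ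
  lsmul_mem : ∀ (a : A) {φ : E → A}, φ ∈ Θ → (fun x => a * φ x) ∈ Θ

/-- Right `A`-module homomorphism between two right `A`-modules. -/
def IsModHom {E F : Type*} [AddCommGroup E] [Module ℂ E] [AddCommGroup F] [Module ℂ F]
    (rE : RightMod A E) (rF : RightMod A F) (U : E → F) : Prop :=
  (∀ x y : E, U (x + y) = U x + U y) ∧ (∀ (c : ℂ) (x : E), U (c • x) = c • U x) ∧
    ∀ (x : E) (a : A), U (rE.sm x a) = rF.sm (U x) a

/-- A homomorphism of functional modules `(U, U^*)`. -/
structure IsFunctionalHom {E F : Type*} [AddCommGroup E] [Module ℂ E]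
    [AddCommGroup F] [Module ℂ F]
    (rE : RightMod A E) (ΘE : Set (E → A)) (rF : RightMod A F) (ΘF : Set (F → A))
    (U : E → F) (Ustar : (E → A) → F → A) : Prop where
  hom : IsModHom rE rF U
  maps_mem : ∀ {φ : E → A}, φ ∈ ΘE → Ustar φ ∈ ΘF
  star_add : ∀ {φ ψ : E → A}, φ ∈ ΘE → ψ ∈ ΘE → Ustar (φ + ψ) = Ustar φ + Ustar ψ
  star_csmul : ∀ (c : ℂ) {φ : E → A}, φ ∈ ΘE → Ustar (c • φ) = c • Ustar φ
  star_lsmul : ∀ (a : A) {φ : E → A}, φ ∈ ΘE →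
      Ustar (fun x => a * φ x) = fun y => a * Ustar φ y
  compat : ∀ {φ : E → A}, φ ∈ ΘE → ∀ x : E, Ustar φ (U x) = φ x

/-- A functional extension. -/
structure IsFunctionalExtension {E F : Type*} [AddCommGroup E] [Module ℂ E]
    [AddCommGroup F] [Module ℂ F]
    (rE : RightMod A E) (ΘE : Set (E → A)) (rF : RightMod A F) (ΘF : Set (F → A))
    (U : E → F) (Ustar : (E → A) → F → A)
    extends IsFunctionalHom rE ΘE rF ΘF U Ustar : Prop where
  inj : Function.Injective U
  lift : ∀ (k : ℕ) (φ : Fin k → E → A), (∀ i, φ i ∈ ΘE) → ∀ η : F,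
      ∃ ξ : E, ∀ i, Ustar (φ i) η = φ i ξ

/-- The elementary compact operator `θ_{η,φ}`. -/
def elemOp {E : Type*} [AddCommGroup E] [Module ℂ E]
    (r : RightMod A E) (η : E) (φ : E → A) : E → E :=
  fun ξ => r.sm η (φ ξ)

/-- The set of compact operators on `(E, r, Θ)`: finite sums of elementary operators. -/
def KSet {E : Type*} [AddCommGroup E] [Module ℂ E]
    (r : RightMod A E) (Θ : Set (E → A)) : Set (E → E) :=
  { T | ∃ (m : ℕ) (η : Fin m → E) (φ : Fin m → E → A),
      (∀ i, φ i ∈ Θ) ∧ T = ∑ i, elemOp r (η i) (φ i) }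

end

/-- A `G`-action on the algebra `A` by (ℂ-linear) algebra automorphisms. -/
structure AlgAction (G : Type*) [Group G] (A : Type*) [NonUnitalRing A] [Module ℂ A] where
  act : G → A → A
  map_add : ∀ (g : G) (x y : A), act g (x + y) = act g x + act g y
  map_mul : ∀ (g : G) (x y : A), act g (x * y) = act g x * act g y
  map_csmul : ∀ (g : G) (c : ℂ) (x : A), act g (c • x) = c • act g x
  act_one : ∀ x : A, act 1 x = x
  act_mul : ∀ (g h : G) (x : A), act (g * h) x = act g (act h x)

/-- A `G`-action on a right `A`-module compatible with the action `α` on `A`. -/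
structure ModAction (G : Type*) [Group G] {A E : Type*} [NonUnitalRing A] [Module ℂ A]
    [AddCommGroup E] [Module ℂ E] (α : AlgAction G A) (r : RightMod A E) where
  act : G → E → E
  map_add : ∀ (g : G) (x y : E), act g (x + y) = act g x + act g y
  map_csmul : ∀ (g : G) (c : ℂ) (x : E), act g (c • x) = c • act g x
  act_sm : ∀ (g : G) (x : E) (a : A), act g (r.sm x a) = r.sm (act g x) (α.act g a)
  act_one : ∀ x : E, act 1 x = x
  act_mul : ∀ (g h : G) (x : E), act (g * h) x = act g (act h x)

/-- A linear `G`-action on a ℂ-vector space. -/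
structure LinAction (G : Type*) [Group G] (V : Type*) [AddCommGroup V] [Module ℂ V] where
  act : G → V → V
  map_add : ∀ (g : G) (x y : V), act g (x + y) = act g x + act g y
  map_csmul : ∀ (g : G) (c : ℂ) (x : V), act g (c • x) = c • act g x
  act_one : ∀ x : V, act 1 x = x
  act_mul : ∀ (g h : G) (x : V), act (g * h) x = act g (act h x)

/-- Invariance of a functional space under the induced action `g(φ) = α_g ∘ φ ∘ S_{g⁻¹}`. -/
def ThetaInvariant {G A E : Type*} [Group G] [NonUnitalRing A] [Module ℂ A]
    [AddCommGroup E] [Module ℂ E] {r : RightMod A E}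
    (α : AlgAction G A) (S : ModAction G α r) (Θ : Set (E → A)) : Prop :=
  ∀ g : G, ∀ φ ∈ Θ, (fun ξ => α.act g (φ (S.act g⁻¹ ξ))) ∈ Θ

section Twist

variable {G A E : Type*} [Group G] [NonUnitalRing A] [Module ℂ A]
  [AddCommGroup E] [Module ℂ E]

/-- The right `A`-module `⊕_{g ∈ G} E` (all families, `G` finite in applications)
with the twisted action `(⊕_g ξ_g)·a := ⊕_g ξ_g·α_{g⁻¹}(a)`. -/
def twistMod (α : AlgAction G A) (r : RightMod A E) : RightMod A (G → E) where
  sm x a := fun g => r.sm (x g) (α.act g⁻¹ a)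
  add_sm x y a := by funext g; simp [r.add_sm]
  sm_add x a b := by funext g; simp [α.map_add, r.sm_add]
  sm_mul x a b := by funext g; simp [α.map_mul, r.sm_mul]
  csm_left c x a := by funext g; simp [r.csm_left]
  csm_right c x a := by funext g; simp [α.map_csmul, r.csm_right]

/-- The functional space `{⊕_g α_g ∘ χ_g : χ_g ∈ Θ}` on `⊕_{g ∈ G} E`,
where `(⊕_g ψ_g)(⊕_g ξ_g) = Σ_g ψ_g(ξ_g)`. -/
def twistTheta [Fintype G] (α : AlgAction G A) (Θ : Set (E → A)) : Set ((G → E) → A) :=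
  { f | ∃ χ : G → E → A, (∀ g, χ g ∈ Θ) ∧ ∀ x : G → E, f x = ∑ g : G, α.act g (χ g (x g)) }

/-- The shift `G`-action `U_h(⊕_g ξ_g) := ⊕_g ξ_{h⁻¹g}` on the twisted module. -/
def shiftAction (α : AlgAction G A) (r : RightMod A E) :
    ModAction G α (twistMod α r) where
  act h x := fun g => x (h⁻¹ * g)
  map_add _ _ _ := rfl
  map_csmul _ _ _ := rfl
  act_sm h x a := by
    funext g
    show r.sm (x (h⁻¹ * g)) (α.act (h⁻¹ * g)⁻¹ a) =
      r.sm (x (h⁻¹ * g)) (α.act g⁻¹ (α.act h a))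
    rw [← α.act_mul, mul_inv_rev, inv_inv]
  act_one x := by funext g; simp
  act_mul g h x := by funext k; simp [mul_assoc]

end Twist

section Amplification

variable {A E F H : Type*} [NonUnitalRing A] [Module ℂ A]
  [AddCommGroup E] [Module ℂ E] [AddCommGroup F] [Module ℂ F] [AddCommGroup H] [Module ℂ H]

/-- Functional extensions compose. -/
theorem IsFunctionalExtension.comp {rE : RightMod A E} {ΘE : Set (E → A)}
    {rF : RightMod A F} {ΘF : Set (F → A)} {rH : RightMod A H} {ΘH : Set (H → A)}
    {V : F → H} {Vs : (F → A) → H → A} {U : E → F} {Us : (E → A) → F → A}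
    (hV : IsFunctionalExtension rF ΘF rH ΘH V Vs)
    (hU : IsFunctionalExtension rE ΘE rF ΘF U Us) :
    IsFunctionalExtension rE ΘE rH ΘH (V ∘ U) (Vs ∘ Us) where
  hom := by
    obtain ⟨hV₁, hV₂, hV₃⟩ := hV.hom
    obtain ⟨hU₁, hU₂, hU₃⟩ := hU.hom
    exact ⟨fun x y => by simp [hU₁, hV₁], fun c x => by simp [hU₂, hV₂],
      fun x a => by simp [hU₃, hV₃]⟩
  maps_mem hφ := hV.maps_mem (hU.maps_mem hφ)
  star_add hφ hψ := by
    simp only [Function.comp_apply]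
    rw [hU.star_add hφ hψ, hV.star_add (hU.maps_mem hφ) (hU.maps_mem hψ)]
  star_csmul c _ hφ := by
    simp only [Function.comp_apply]
    rw [hU.star_csmul c hφ, hV.star_csmul c (hU.maps_mem hφ)]
  star_lsmul a _ hφ := by
    simp only [Function.comp_apply]
    rw [hU.star_lsmul a hφ, hV.star_lsmul a (hU.maps_mem hφ)]
  compat hφ x := by
    simp only [Function.comp_apply]
    rw [hV.compat (hU.maps_mem hφ), hU.compat hφ]
  inj := hV.inj.comp hU.inj
  lift k φ hφ η := by
    obtain ⟨ζ, hζ⟩ := hV.lift k (fun i => Us (φ i)) (fun i => hU.maps_mem (hφ i)) η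
    obtain ⟨ξ, hξ⟩ := hU.lift k φ hφ ζ
    exact ⟨ξ, fun i => (hζ i).trans (hξ i)⟩

theorem IsFunctional.map_zero {r : RightMod A E} {f : E → A} (hf : IsFunctional r f) :
    f 0 = 0 := by
  simpa using hf.1 0 0

theorem IsFunctional.map_sum {r : RightMod A E} {f : E → A} (hf : IsFunctional r f)
    {ι : Type*} (s : Finset ι) (x : ι → E) : f (∑ i ∈ s, x i) = ∑ i ∈ s, f (x i) :=
  _root_.map_sum (AddMonoidHom.mk' f hf.1) x s

variable {G : Type*} [Group G]

namespace AlgAction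

theorem map_zero (α : AlgAction G A) (g : G) : α.act g 0 = 0 := by
  simpa using α.map_add g 0 0

theorem act_inv_act (α : AlgAction G A) (g : G) (a : A) : α.act g⁻¹ (α.act g a) = a := by
  rw [← α.act_mul, inv_mul_cancel, α.act_one]

theorem act_act_inv (α : AlgAction G A) (g : G) (a : A) : α.act g (α.act g⁻¹ a) = a := by
  rw [← α.act_mul, mul_inv_cancel, α.act_one]

end AlgAction

theorem ModAction.act_act_inv {α : AlgAction G A} {r : RightMod A E} (S : ModAction G α r)
    (g : G) (x : E) : S.act g (S.act g⁻¹ x) = x := by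
  rw [← S.act_mul, mul_inv_cancel, S.act_one]

/-- For an invariant functional space, `α_{g⁻¹} ∘ φ ∘ S_g` is again in the space. -/
theorem ThetaInvariant.mem_inv {α : AlgAction G A} {r : RightMod A E} {S : ModAction G α r}
    {Θ : Set (E → A)} (hinv : ThetaInvariant α S Θ) (g : G) {φ : E → A} (hφ : φ ∈ Θ) :
    (fun ξ => α.act g⁻¹ (φ (S.act g ξ))) ∈ Θ := by
  simpa using hinv g⁻¹ φ hφ

variable [Fintype G] {X Y : Type*}

/-- The functional `⊕_g α_g ∘ χ_g` on families `G → X`. -/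
def twistFunctional (α : AlgAction G A) (χ : G → X → A) : (G → X) → A :=
  fun x => ∑ g : G, α.act g (χ g (x g))

theorem mem_twistTheta_iff {α : AlgAction G A} {Θ : Set (X → A)} {f : (G → X) → A} :
    f ∈ twistTheta α Θ ↔ ∃ χ : G → X → A, (∀ g, χ g ∈ Θ) ∧ f = twistFunctional α χ :=
  ⟨fun ⟨χ, hχ, h⟩ => ⟨χ, hχ, funext h⟩, fun ⟨χ, hχ, h⟩ => ⟨χ, hχ, congrFun h⟩⟩

theorem twistFunctional_add (α : AlgAction G A) (χ ψ : G → X → A) :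
    twistFunctional α χ + twistFunctional α ψ = twistFunctional α (fun g => χ g + ψ g) := by
  funext x
  simp [twistFunctional, α.map_add, Finset.sum_add_distrib]

theorem smul_twistFunctional (α : AlgAction G A) (c : ℂ) (χ : G → X → A) :
    c • twistFunctional α χ = twistFunctional α (fun g => c • χ g) := by
  funext x
  simp [twistFunctional, α.map_csmul, Finset.smul_sum]

theorem mul_twistFunctional (α : AlgAction G A) (a : A) (χ : G → X → A) :
    (fun x => a * twistFunctional α χ x) =
      twistFunctional α (fun g x => α.act g⁻¹ a * χ g x) := by
  funext x
  simp [twistFunctional, α.map_mul, α.act_act_inv, Finset.mul_sum]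

open Classical in
/-- The map `⊕_g α_g ∘ χ_g ↦ ⊕_g α_g ∘ Γ^*(χ_g)`, where `χ_g` is recovered by restricting the
functional to the summand indexed by `g`. -/
noncomputable def amplifiedStar [Zero X] (α : AlgAction G A) (Γs : (X → A) → Y → A)
    (f : (G → X) → A) : (G → Y) → A :=
  twistFunctional α fun g => Γs fun x => α.act g⁻¹ (f (Pi.single g x))

theorem amplifiedStar_twistFunctional [Zero X] (α : AlgAction G A) (Γs : (X → A) → Y → A)
    {χ : G → X → A} (hχ : ∀ g, χ g 0 = 0) :
    amplifiedStar α Γs (twistFunctional α χ) = twistFunctional α fun g => Γs (χ g) := by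
  classical
  unfold amplifiedStar
  congr 1
  funext g
  congr 1
  funext x
  have : twistFunctional α χ (Pi.single g x) = α.act g (χ g x) := by
    refine (Finset.sum_eq_single g (fun h _ hne => ?_) (by simp)).trans (by simp)
    rw [Pi.single_eq_of_ne hne, hχ, α.map_zero]
  convert α.act_inv_act g (χ g x)

/-- The amplification of a functional extension is a functional extension of the twisted
modules. -/
theorem IsFunctionalExtension.amplified (α : AlgAction G A) {rE : RightMod A E}
    {ΘE : Set (E → A)} (hE : IsFunctionalSpace rE ΘE) {rF : RightMod A F} {ΘF : Set (F → A)}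
    {Γ : E → F} {Γs : (E → A) → F → A} (hΓ : IsFunctionalExtension rE ΘE rF ΘF Γ Γs) :
    IsFunctionalExtension (twistMod α rE) (twistTheta α ΘE) (twistMod α rF) (twistTheta α ΘF)
      (fun (x : G → E) g => Γ (x g)) (amplifiedStar α Γs) := by
  have star {χ : G → E → A} (hχ : ∀ g, χ g ∈ ΘE) :
      amplifiedStar α Γs (twistFunctional α χ) = twistFunctional α fun g => Γs (χ g) :=
    amplifiedStar_twistFunctional α Γs fun g => (hE.functional _ (hχ g)).map_zero
  refine ⟨⟨⟨?_, ?_, ?_⟩, ?_, ?_, ?_, ?_, ?_⟩, ?_, ?_⟩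
  · exact fun x y => funext fun g => hΓ.hom.1 _ _
  · exact fun c x => funext fun g => hΓ.hom.2.1 _ _
  · exact fun x a => funext fun g => hΓ.hom.2.2 _ _
  · intro φ hφ
    obtain ⟨χ, hχ, rfl⟩ := mem_twistTheta_iff.1 hφ
    exact mem_twistTheta_iff.2 ⟨_, fun g => hΓ.maps_mem (hχ g), star hχ⟩
  · intro φ ψ hφ hψ
    obtain ⟨χ, hχ, rfl⟩ := mem_twistTheta_iff.1 hφ
    obtain ⟨ω, hω, rfl⟩ := mem_twistTheta_iff.1 hψ
    rw [twistFunctional_add, star fun g => hE.add_mem (hχ g) (hω g), star hχ, star hω,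
      twistFunctional_add]
    simp only [hΓ.star_add (hχ _) (hω _)]
  · intro c φ hφ
    obtain ⟨χ, hχ, rfl⟩ := mem_twistTheta_iff.1 hφ
    rw [smul_twistFunctional, star fun g => hE.csmul_mem c (hχ g), star hχ,
      smul_twistFunctional]
    simp only [hΓ.star_csmul c (hχ _)]
  · intro a φ hφ
    obtain ⟨χ, hχ, rfl⟩ := mem_twistTheta_iff.1 hφ
    rw [mul_twistFunctional, star fun g => hE.lsmul_mem _ (hχ g), star hχ,
      mul_twistFunctional]
    simp only [hΓ.star_lsmul _ (hχ _)]
  · intro φ hφ x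
    obtain ⟨χ, hχ, rfl⟩ := mem_twistTheta_iff.1 hφ
    rw [star hχ]
    simp only [twistFunctional, hΓ.compat (hχ _)]
  · exact fun x y hxy => funext fun g => hΓ.inj (congrFun hxy g)
  · intro k φ hφ η
    choose χ hχ hφχ using fun i => mem_twistTheta_iff.1 (hφ i)
    choose ξ hξ using fun g => hΓ.lift k (fun i => χ i g) (fun i => hχ i g) (η g)
    refine ⟨ξ, fun i => ?_⟩
    rw [hφχ i, star (hχ i)]
    simp only [twistFunctional, hξ]

/-- The regular embedding `π(ξ) = ⊕_g S_{g⁻¹}(ξ)`, `π^*(φ) = |G|⁻¹ ⊕_g φ ∘ S_g` is a functional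
extension. -/
theorem isFunctionalExtension_regular {α : AlgAction G A} {r : RightMod A E}
    {Θ : Set (E → A)} (hΘ : IsFunctionalSpace r Θ) (S : ModAction G α r)
    (hinv : ThetaInvariant α S Θ) [SMulCommClass ℂ A A] :
    IsFunctionalExtension r Θ (twistMod α r) (twistTheta α Θ) (fun ξ g => S.act g⁻¹ ξ)
      (fun φ x => (Fintype.card G : ℂ)⁻¹ • ∑ g : G, φ (S.act g (x g))) := by
  have hcard : (Fintype.card G : ℂ) ≠ 0 := Nat.cast_ne_zero.2 Fintype.card_ne_zero
  refine ⟨⟨⟨?_, ?_, ?_⟩, ?_, ?_, ?_, ?_, ?_⟩, ?_, ?_⟩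
  · exact fun x y => funext fun g => S.map_add _ _ _
  · exact fun c x => funext fun g => S.map_csmul _ _ _
  · exact fun x a => funext fun g => S.act_sm _ _ _
  · intro φ hφ
    refine ⟨fun g => (Fintype.card G : ℂ)⁻¹ • fun ξ => α.act g⁻¹ (φ (S.act g ξ)),
      fun g => hΘ.csmul_mem _ (hinv.mem_inv g hφ), fun x => ?_⟩
    simp [α.map_csmul, α.act_act_inv, Finset.smul_sum]
  · intro φ ψ _ _
    funext x
    simp [Finset.sum_add_distrib]
  · intro c φ _
    funext x
    simp only [Pi.smul_apply, ← Finset.smul_sum]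
    rw [smul_comm]
  · intro a φ _
    funext x
    simp only [← Finset.mul_sum, mul_smul_comm]
  · intro φ _ ξ
    simp only [S.act_act_inv, Finset.sum_const, Finset.card_univ]
    rw [← Nat.cast_smul_eq_nsmul ℂ, inv_smul_smul₀ hcard]
  · intro x y hxy
    simpa [S.act_one] using congrFun hxy 1
  · intro k φ hφ η
    refine ⟨(Fintype.card G : ℂ)⁻¹ • ∑ g : G, S.act g (η g), fun i => ?_⟩
    have hf := hΘ.functional _ (hφ i)
    rw [hf.2.1, hf.map_sum]

end Amplification

/-- For a finite group `G`, a `G`-equivariant functional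
`(A,α)`-module `(E,S)` and a *non-equivariant* functional extension
`(Γ,Γ^*) : E → F`, the amplification `σ(⊕_g ξ_g) = ⊕_g Γ(ξ_g)`,
`σ^*(⊕_g α_g ∘ χ_g) = ⊕_g α_g ∘ Γ^*(χ_g)` is a `G`-equivariant functional
extension `(⊕_G E, U) → (⊕_G F, V)` of the twisted modules with shift actions,
and hence `σ ∘ π` is a `G`-equivariant functional extension of `(E,S)` into
`(⊕_G F, V)`. -/
theorem amplified_functional_extension
    {G A E F : Type*} [Group G] [Fintype G] [NonUnitalRing A] [Module ℂ A]
    [SMulCommClass ℂ A A] [IsScalarTower ℂ A A]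
    [AddCommGroup E] [Module ℂ E] [AddCommGroup F] [Module ℂ F]
    (α : AlgAction G A) (rE : RightMod A E) (ΘE : Set (E → A))
    (hE : IsFunctionalSpace rE ΘE)
    (S : ModAction G α rE) (hinv : ThetaInvariant α S ΘE)
    (rF : RightMod A F) (ΘF : Set (F → A)) (hF : IsFunctionalSpace rF ΘF)
    (Γ : E → F) (Γs : (E → A) → F → A)
    (hΓ : IsFunctionalExtension rE ΘE rF ΘF Γ Γs) :
    ∃ σstar : ((G → E) → A) → (G → F) → A,
      -- `σ^*` is given by the coordinatewise formula
      (∀ χ : G → E → A, (∀ g, χ g ∈ ΘE) →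
        σstar (fun x => ∑ g : G, α.act g (χ g (x g))) =
          fun y => ∑ g : G, α.act g (Γs (χ g) (y g))) ∧
      -- `σ` is a `G`-equivariant functional extension
      IsFunctionalExtension (twistMod α rE) (twistTheta α ΘE)
        (twistMod α rF) (twistTheta α ΘF) (fun x => fun g => Γ (x g)) σstar ∧
      (∀ (g : G) (x : G → E),
        (fun h => Γ ((shiftAction α rE).act g x h)) =
          (shiftAction α rF).act g (fun h => Γ (x h))) ∧
      -- the composition `σ ∘ π` is a `G`-equivariant functional extension
      IsFunctionalExtension rE ΘE (twistMod α rF) (twistTheta α ΘF)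
        (fun ξ => fun g => Γ (S.act g⁻¹ ξ))
        (σstar ∘ fun φ => fun x : G → E =>
          ((Fintype.card G : ℂ))⁻¹ • ∑ g : G, φ (S.act g (x g))) ∧
      (∀ (g : G) (ξ : E),
        (fun h => Γ (S.act h⁻¹ (S.act g ξ))) =
          (shiftAction α rF).act g (fun h => Γ (S.act h⁻¹ ξ))) := by
  refine ⟨amplifiedStar α Γs, fun χ hχ => ?_, hΓ.amplified α hE, fun _ _ => rfl,
    (hΓ.amplified α hE).comp (isFunctionalExtension_regular hE S hinv), fun g ξ => ?_⟩
  · exact amplifiedStar_twistFunctional α Γs fun g => (hE.functional _ (hχ g)).map_zero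
  · funext h
    simp [shiftAction, ← S.act_mul]
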